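/- Fix an integer n ≥ 3, positive revision rates λ_1,…,λ_n, a positive normalization constant τ̄, and sign-preserving Lipschitz functions φ_1,…,φ_n defining an RM-PC protocol, and assume the worst-case revision rate ratio satisfies λ_R < λ̄_φ(n). Then for all x in the simplex X and all p ∈ ℝ^n, the quantity 𝔖(x,p) = −(1/τ̄) Σ_{i=1}^n λ_i V_i(x,p) γ_i(p) equals zero if and only if x is supported on maximizers of p (i.e., x_j > 0 only when p_j = max_{k} p_k); equivalently, 𝔖(x,p) = 0 if and only if x ∈ argmax_{y ∈ X} yᵀp. -/

import Mathlib

open scoped BigOperators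
open Finset

noncomputable section

namespace RMPC

/-- The probability simplex in `ℝ^n`. -/
def simplex (n : ℕ) : Set (Fin n → ℝ) :=
  {x | (∀ i, 0 ≤ x i) ∧ ∑ i, x i = 1}

/-- A function `φ : ℝ → ℝ` is sign-preserving if it is positive on positive
arguments and vanishes on nonpositive ones (hence takes values in `ℝ_{≥0}`). -/
def SignPreserving (φ : ℝ → ℝ) : Prop :=
  (∀ s : ℝ, 0 < s → 0 < φ s) ∧ (∀ s : ℝ, s ≤ 0 → φ s = 0)

/-- The RM-PC mean dynamics
`V_i(x,p) = Σ_{j≠i} λ_j (1/τ̄) φ_i(p_i − p_j) x_j − Σ_{j≠i} λ_i (1/τ̄) φ_j(p_j − p_i) x_i`. -/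
def Vdyn (n : ℕ) (lam : Fin n → ℝ) (τ : ℝ) (φ : Fin n → ℝ → ℝ)
    (x p : Fin n → ℝ) (i : Fin n) : ℝ :=
  (∑ j ∈ Finset.univ.erase i, lam j * (1 / τ) * φ i (p i - p j) * x j)
    - ∑ j ∈ Finset.univ.erase i, lam i * (1 / τ) * φ j (p j - p i) * x i

/-- `ψ(s) = ∫_0^s φ(r) dr`. -/
def psiF (φ : ℝ → ℝ) (s : ℝ) : ℝ := ∫ r in (0:ℝ)..s, φ r

/-- `γ_i(p) = Σ_k ψ_k(p_k − p_i)`. -/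
def gammaF (n : ℕ) (φ : Fin n → ℝ → ℝ) (i : Fin n) (p : Fin n → ℝ) : ℝ :=
  ∑ k, psiF (φ k) (p k - p i)

/-- Worst-case revision rate ratio `λ_R = max { λ_i / λ_j }`. -/
def lamR (n : ℕ) (lam : Fin n → ℝ) : ℝ :=
  ⨆ ij : Fin n × Fin n, lam ij.1 / lam ij.2

/-- The set of values `γ_k(p) Σ_i φ_i(p_i − p_k) / Σ_i φ_i(p_i − p_k) γ_i(p)`,
over `p` with nonvanishing denominator. -/
def thresholdSet (n : ℕ) (φ : Fin n → ℝ → ℝ) (k : Fin n) : Set ℝ :=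
  {c | ∃ p : Fin n → ℝ,
    (∑ i, φ i (p i - p k) * gammaF n φ i p) ≠ 0 ∧
    c = (gammaF n φ k p * ∑ i, φ i (p i - p k)) /
        (∑ i, φ i (p i - p k) * gammaF n φ i p)}

/-- The threshold `λ̄_φ(n)`. -/
def lamBar (n : ℕ) (φ : Fin n → ℝ → ℝ) : ℝ :=
  ⨅ k : Fin n, sInf (thresholdSet n φ k)

/-- The δ-storage function `S(x,p) = (1/τ̄) Σ_i λ_i x_i γ_i(p)`. -/
def Sfun (n : ℕ) (lam : Fin n → ℝ) (τ : ℝ) (φ : Fin n → ℝ → ℝ)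
    (x p : Fin n → ℝ) : ℝ :=
  (1 / τ) * ∑ i, lam i * x i * gammaF n φ i p

/-- The dissipation rate `𝔖(x,p) = −(1/τ̄) Σ_i λ_i V_i(x,p) γ_i(p)`. -/
def SigFun (n : ℕ) (lam : Fin n → ℝ) (τ : ℝ) (φ : Fin n → ℝ → ℝ)
    (x p : Fin n → ℝ) : ℝ :=
  -((1 / τ) * ∑ i, lam i * Vdyn n lam τ φ x p i * gammaF n φ i p)

theorem psi_nonpos {f : ℝ → ℝ} (hf : SignPreserving f) {s : ℝ} (hs : s ≤ 0) : psiF f s = 0 := by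
  unfold psiF
  apply intervalIntegral.integral_zero_ae
  refine Filter.Eventually.of_forall fun r hr => ?_
  rw [Set.uIoc_of_ge hs] at hr
  exact hf.2 r hr.2

theorem psi_pos {f : ℝ → ℝ} (hf : SignPreserving f) (hL : ∃ K, LipschitzWith K f) {s : ℝ}
    (hs : 0 < s) : 0 < psiF f s := by
  obtain ⟨K, hK⟩ := hL
  exact intervalIntegral.intervalIntegral_pos_of_pos_on (hK.continuous.intervalIntegrable _ _)
    (fun r hr => hf.1 r hr.1) hs

theorem psi_nonneg {f : ℝ → ℝ} (hf : SignPreserving f) (hL : ∃ K, LipschitzWith K f) (s : ℝ) :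
    0 ≤ psiF f s := by
  rcases le_or_gt s 0 with h | h
  · exact (psi_nonpos hf h).ge
  · exact (psi_pos hf hL h).le

theorem phi_nonneg {f : ℝ → ℝ} (hf : SignPreserving f) (s : ℝ) : 0 ≤ f s := by
  rcases le_or_gt s 0 with h | h
  · exact (hf.2 s h).ge
  · exact (hf.1 s h).le

theorem supp_iff (n : ℕ) (x p : Fin n → ℝ) (hx : x ∈ simplex n) (hn : 3 ≤ n) :
    (∀ j, 0 < x j → ∀ k, p k ≤ p j) ↔
      ∀ y ∈ simplex n, (∑ i, y i * p i) ≤ ∑ i, x i * p i := by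
  obtain ⟨hx0, hx1⟩ := hx
  have : Nonempty (Fin n) := ⟨⟨0, by omega⟩⟩
  obtain ⟨m, hm⟩ := Finite.exists_max p
  constructor
  · rintro h y ⟨hy0, hy1⟩
    have e : ∑ i, x i * p i = ∑ i, x i * p m := by
      refine Finset.sum_congr rfl fun i _ => ?_
      rcases (hx0 i).eq_or_lt with h0 | h0
      · rw [← h0]; simp
      · rw [le_antisymm (hm i) (h i h0 m)]
    rw [e, ← Finset.sum_mul, hx1, ← hy1, Finset.sum_mul]
    exact Finset.sum_le_sum fun i _ => mul_le_mul_of_nonneg_left (hm i) (hy0 i)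
  · intro h j hj k
    have h1 := h (Pi.single m 1) ⟨fun i => by
      by_cases hi : i = m
      · subst hi; simp
      · simp [hi], by simp⟩
    have h2 : ∑ i, (Pi.single m 1 : Fin n → ℝ) i * p i = p m := by
      simp [Pi.single_apply]
    rw [h2] at h1
    have h3 : ∑ i, x i * (p m - p i) ≤ 0 := by
      simp only [mul_sub, Finset.sum_sub_distrib, ← Finset.sum_mul, hx1]
      linarith
    have h4 := Finset.single_le_sum (f := fun i => x i * (p m - p i))
      (fun i _ => mul_nonneg (hx0 i) (sub_nonneg.2 (hm i))) (Finset.mem_univ j)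
    have h5 : x j * (p m - p j) ≤ 0 := h4.trans h3
    have h6 : p m - p j ≤ 0 := by
      by_contra hc
      have := mul_pos hj (not_le.1 hc)
      linarith
    linarith [hm k]

/-- dissipation contributed by strategy `j` -/
def Dj (n : ℕ) (lam : Fin n → ℝ) (φ : Fin n → ℝ → ℝ) (p : Fin n → ℝ) (j : Fin n) : ℝ :=
  lam j * (gammaF n φ j p * ∑ i, φ i (p i - p j))
    - ∑ i, lam i * (φ i (p i - p j) * gammaF n φ i p)

theorem Sig_eq (n : ℕ) (lam : Fin n → ℝ) (τ : ℝ) (φ : Fin n → ℝ → ℝ)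
    (hφ : ∀ j, SignPreserving (φ j)) (x p : Fin n → ℝ) :
    SigFun n lam τ φ x p = (1 / τ) * ((1 / τ) * ∑ j, x j * (lam j * Dj n lam φ p j)) := by
  have hV : ∀ i, Vdyn n lam τ φ x p i =
      (1 / τ) * ((∑ j, lam j * φ i (p i - p j) * x j) - ∑ j, lam i * φ j (p j - p i) * x i) := by
    intro i
    have hz : φ i (p i - p i) = 0 := (hφ i).2 _ (by simp)
    unfold Vdyn
    rw [Finset.sum_erase _ (by rw [hz]; ring), Finset.sum_erase _ (by rw [hz]; ring), mul_sub,
      Finset.mul_sum, Finset.mul_sum]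
    congr 1 <;> exact Finset.sum_congr rfl fun j _ => by ring
  unfold SigFun Dj
  simp only [hV]
  rw [← mul_neg, ← Finset.sum_neg_distrib]
  congr 1
  have e1 : ∀ i, -(lam i * ((1 / τ) * ((∑ j, lam j * φ i (p i - p j) * x j)
      - ∑ j, lam i * φ j (p j - p i) * x i)) * gammaF n φ i p) =
      (1 / τ) * ((∑ j, lam i * lam i * φ j (p j - p i) * x i * gammaF n φ i p)
      - ∑ j, lam i * lam j * φ i (p i - p j) * x j * gammaF n φ i p) := by
    intro i
    have a1 : ∑ j, lam i * lam i * φ j (p j - p i) * x i * gammaF n φ i p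
      = lam i * gammaF n φ i p * ∑ j, lam i * φ j (p j - p i) * x i := by
      rw [Finset.mul_sum]; exact Finset.sum_congr rfl fun j _ => by ring
    have a2 : ∑ j, lam i * lam j * φ i (p i - p j) * x j * gammaF n φ i p
      = lam i * gammaF n φ i p * ∑ j, lam j * φ i (p i - p j) * x j := by
      rw [Finset.mul_sum]; exact Finset.sum_congr rfl fun j _ => by ring
    rw [a1, a2]; ring
  rw [Finset.sum_congr rfl fun i _ => e1 i, ← Finset.mul_sum]
  congr 1
  rw [Finset.sum_sub_distrib]
  rw [Finset.sum_comm (f := fun i j => lam i * lam j * φ i (p i - p j) * x j * gammaF n φ i p),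
    ← Finset.sum_sub_distrib]
  refine Finset.sum_congr rfl fun j _ => ?_
  rw [mul_sub, mul_sub]
  simp only [Finset.mul_sum]
  congr 1 <;> exact Finset.sum_congr rfl fun i _ => by ring

theorem Dj_zero (n : ℕ) (lam : Fin n → ℝ) (φ : Fin n → ℝ → ℝ)
    (hφ : ∀ j, SignPreserving (φ j)) (p : Fin n → ℝ) (j : Fin n) (h : ∀ k, p k ≤ p j) :
    Dj n lam φ p j = 0 := by
  have : ∀ i, φ i (p i - p j) = 0 := fun i => (hφ i).2 _ (sub_nonpos.2 (h i))
  simp [Dj, this]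

theorem Dj_pos (n : ℕ) (lam : Fin n → ℝ) (hlam : ∀ i, 0 < lam i) (φ : Fin n → ℝ → ℝ)
    (hφ : ∀ j, SignPreserving (φ j)) (hLip : ∀ j, ∃ K, LipschitzWith K (φ j))
    (hcond : lamR n lam < lamBar n φ) (p : Fin n → ℝ) (j k : Fin n) (h : p j < p k) :
    0 < Dj n lam φ p j := by
  have hg : ∀ q i, 0 ≤ gammaF n φ i q := fun q i =>
    Finset.sum_nonneg fun k _ => psi_nonneg (hφ k) (hLip k) _
  have hgj : 0 < gammaF n φ j p :=
    Finset.sum_pos' (fun k _ => psi_nonneg (hφ k) (hLip k) _)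
      ⟨k, Finset.mem_univ _, psi_pos (hφ k) (hLip k) (sub_pos.2 h)⟩
  have hs : 0 < ∑ i, φ i (p i - p j) :=
    Finset.sum_pos' (fun k _ => phi_nonneg (hφ k) _)
      ⟨k, Finset.mem_univ _, (hφ k).1 _ (sub_pos.2 h)⟩
  have hnn : ∀ q l i, 0 ≤ φ i (q i - q l) * gammaF n φ i q := fun q l i =>
    mul_nonneg (phi_nonneg (hφ i) _) (hg q i)
  unfold Dj
  rw [sub_pos]
  have hD : 0 ≤ ∑ i, φ i (p i - p j) * gammaF n φ i p := Finset.sum_nonneg fun i _ => hnn p j i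
  rcases hD.eq_or_lt with h0 | h0
  · have := (Finset.sum_eq_zero_iff_of_nonneg fun i _ => hnn p j i).1 h0.symm
    rw [Finset.sum_eq_zero fun i hi => by rw [this i hi, mul_zero]]
    exact mul_pos (hlam j) (mul_pos hgj hs)
  · have b : lamBar n φ ≤ (gammaF n φ j p * ∑ i, φ i (p i - p j)) /
        (∑ i, φ i (p i - p j) * gammaF n φ i p) := by
      refine (ciInf_le (Set.finite_range _).bddBelow j).trans (csInf_le ⟨0, ?_⟩ ⟨p, h0.ne', rfl⟩)
      rintro c ⟨q, -, rfl⟩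
      exact div_nonneg (mul_nonneg (hg q j) (Finset.sum_nonneg fun i _ => phi_nonneg (hφ i) _))
        (Finset.sum_nonneg fun i _ => hnn q j i)
    have b2 := (lt_div_iff₀ h0).1 (hcond.trans_le b)
    have b3 : ∀ i, lam i ≤ lam j * lamR n lam := fun i => by
      have : lam i / lam j ≤ lamR n lam :=
        le_ciSup (f := fun ij : Fin n × Fin n => lam ij.1 / lam ij.2)
          (Set.finite_range _).bddAbove (i, j)
      rw [div_le_iff₀ (hlam j)] at this
      linarith
    calc ∑ i, lam i * (φ i (p i - p j) * gammaF n φ i p)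
        ≤ ∑ i, lam j * lamR n lam * (φ i (p i - p j) * gammaF n φ i p) :=
          Finset.sum_le_sum fun i _ => mul_le_mul_of_nonneg_right (b3 i) (hnn p j i)
      _ = lam j * (lamR n lam * ∑ i, φ i (p i - p j) * gammaF n φ i p) := by
          rw [← Finset.mul_sum, mul_assoc]
      _ < _ := mul_lt_mul_of_pos_left b2 (hlam j)

/-- For `n ≥ 3` and `λ_R < λ̄_φ(n)`, `𝔖(x,p) = 0` iff `x` is supported on the
maximizers of `p`, equivalently iff `x ∈ argmax_{y ∈ X} yᵀp`. -/
theorem sigma_zero_iff_argmax (n : ℕ) (hn : 3 ≤ n)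
    (lam : Fin n → ℝ) (hlam : ∀ i, 0 < lam i)
    (τ : ℝ) (hτ : 0 < τ)
    (φ : Fin n → ℝ → ℝ)
    (hφ : ∀ j, SignPreserving (φ j))
    (hLip : ∀ j, ∃ K, LipschitzWith K (φ j))
    (hcond : lamR n lam < lamBar n φ) :
    ∀ x ∈ simplex n, ∀ p : Fin n → ℝ,
      (SigFun n lam τ φ x p = 0 ↔ ∀ j, 0 < x j → ∀ k, p k ≤ p j) ∧
      (SigFun n lam τ φ x p = 0 ↔
        ∀ y ∈ simplex n, (∑ i, y i * p i) ≤ ∑ i, x i * p i) := by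
  intro x hx p
  have key : SigFun n lam τ φ x p = 0 ↔ ∀ j, 0 < x j → ∀ k, p k ≤ p j := by
    have hD : ∀ j, 0 ≤ Dj n lam φ p j := fun j => by
      by_cases h : ∀ k, p k ≤ p j
      · exact (Dj_zero n lam φ hφ p j h).ge
      · push Not at h
        obtain ⟨k, hk⟩ := h
        exact (Dj_pos n lam hlam φ hφ hLip hcond p j k hk).le
    have ht : (1 / τ) ≠ 0 := by positivity
    rw [Sig_eq n lam τ φ hφ, mul_eq_zero_iff_left ht, mul_eq_zero_iff_left ht,
      Finset.sum_eq_zero_iff_of_nonneg fun j _ =>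
        mul_nonneg (hx.1 j) (mul_nonneg (hlam j).le (hD j))]
    constructor
    · intro h j hj k
      by_contra hc
      have h1 := Dj_pos n lam hlam φ hφ hLip hcond p j k (not_le.1 hc)
      exact (mul_pos hj (mul_pos (hlam j) h1)).ne' (h j (Finset.mem_univ _))
    · intro h j _
      rcases (hx.1 j).eq_or_lt with h0 | h0
      · rw [← h0, zero_mul]
      · rw [Dj_zero n lam φ hφ p j (h j h0)]; simp
  exact ⟨key, key.trans (supp_iff n x p hx hn)⟩

end RMPC
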